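/- (Claim 6) If a derivation d of 𝒦 vanishes on A₁∪A₂∪A₃∪A₄, then for every p∈I_{1,3} and every k∈ℤ one has d(x^{k_{[p]}+(2−k)_{[p̄]}})=0, i.e. d vanishes on x^α for all α in Γ'_p={k_{[p]}+(2−k)_{[p̄]} : k∈ℤ}⊆Γ. -/

import Mathlib

noncomputable section

/-- `ι_i = ℓ₁ + ⋯ + ℓ_i`. -/
def iot (ℓ : ℕ → ℕ) (i : ℕ) : ℕ := ∑ k ∈ Finset.Icc 1 i, ℓ k

/-- `I_{i,j} = {ι_{i-1}+1, …, ι_j}`. -/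
def iSet (ℓ : ℕ → ℕ) (i j : ℕ) : Finset ℕ := Finset.Icc (iot ℓ (i - 1) + 1) (iot ℓ j)

/-- The index-shift map `p ↦ p̄` (shift by `ι₆`). -/
def bar (ℓ : ℕ → ℕ) (p : ℕ) : ℕ := if p ≤ iot ℓ 6 then p + iot ℓ 6 else p - iot ℓ 6

/-- `K̄ = {p̄ : p ∈ K}`. -/
def barSet (ℓ : ℕ → ℕ) (K : Finset ℕ) : Finset ℕ := K.image (bar ℓ)

/-- `J_{i,j} = I_{i,j} ∪ Ī_{i,j}`. -/
def jSet (ℓ : ℕ → ℕ) (i j : ℕ) : Finset ℕ := iSet ℓ i j ∪ barSet ℓ (iSet ℓ i j)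

/-- The semigroup `𝒥 = 𝒥₀ × 𝒥₁`, encoded as functions `ℕ → ℕ`; `j0 = true`
means `𝒥₀ = ℕ` and `j0 = false` means `𝒥₀ = {0}`. -/
def jIdx (ℓ : ℕ → ℕ) (j0 : Bool) : Set (ℕ → ℕ) :=
  {i | (j0 = false → i 0 = 0) ∧
    ∀ p, 1 ≤ p →
      (p ∈ iSet ℓ 1 2 ∪ iSet ℓ 4 4 ∪ barSet ℓ (iSet ℓ 1 1) ∨ 2 * iot ℓ 6 < p) → i p = 0}

/-- `σ_p` (with `σ_p = σ_{p̄}`). -/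
def sgm (F : Type*) [Field F] (ℓ : ℕ → ℕ) (p : ℕ) : ℕ → F :=
  let q := if p ≤ iot ℓ 6 then p else p - iot ℓ 6
  if q ∈ iSet ℓ 1 3 then -Pi.single q (1 : F) - Pi.single (q + iot ℓ 6) (1 : F)
  else if q ∈ iSet ℓ 4 5 then -Pi.single q (1 : F)
  else 0

/-- The underlying space `𝒜`: the free `F`-module with basis `Γ × 𝒥`. -/
abbrev CA (F : Type*) [Field F] (ℓ : ℕ → ℕ) (Γ : AddSubgroup (ℕ → F)) (j0 : Bool) : Type _ :=
  (↥Γ × ↥(jIdx ℓ j0)) →₀ F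

/-- The basis monomial `x^{α,i⃗}`, with the convention that it is `0` if `(α,i⃗) ∉ Γ × 𝒥`. -/
def X (F : Type*) [Field F] (ℓ : ℕ → ℕ) (Γ : AddSubgroup (ℕ → F)) (j0 : Bool)
    (α : ℕ → F) (i : ℕ → ℕ) : CA F ℓ Γ j0 :=
  @dite _ (α ∈ Γ ∧ i ∈ jIdx ℓ j0) (Classical.dec _)
    (fun h => Finsupp.single (⟨α, h.1⟩, ⟨i, h.2⟩) 1) (fun _ => 0)

variable (F : Type*) [Field F] (ℓ : ℕ → ℕ) (Γ : AddSubgroup (ℕ → F)) (j0 : Bool)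

/-- The commutative associative product on `𝒜`. -/
def mulA (u v : CA F ℓ Γ j0) : CA F ℓ Γ j0 :=
  u.sum fun a ca => v.sum fun b cb =>
    (ca * cb) • X F ℓ Γ j0 (a.1.1 + b.1.1) (a.2.1 + b.2.1)

/-- The grading operator `∂*_p`. -/
def pstar (p : ℕ) (u : CA F ℓ Γ j0) : CA F ℓ Γ j0 :=
  u.sum fun a ca => (ca * a.1.1 p) • Finsupp.single a 1

/-- The down-grading operator `∂_{t_p}`. -/
def pt (p : ℕ) (u : CA F ℓ Γ j0) : CA F ℓ Γ j0 :=
  u.sum fun a ca => (ca * (a.2.1 p : F)) • X F ℓ Γ j0 a.1.1 (a.2.1 - Pi.single p 1)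

/-- `∂_p = ∂*_p + ∂_{t_p}`. -/
def dd (p : ℕ) (u : CA F ℓ Γ j0) : CA F ℓ Γ j0 := pstar F ℓ Γ j0 p u + pt F ℓ Γ j0 p u

/-- `∂ = Σ_{p∈J_{1,3}∪I_{4,5}} ∂*_p + Σ_{p∈I₆∪Ī_{4,6}} t_p ∂_{t_p}`. -/
def Dop (u : CA F ℓ Γ j0) : CA F ℓ Γ j0 :=
  (∑ p ∈ jSet ℓ 1 3 ∪ iSet ℓ 4 5, pstar F ℓ Γ j0 p u) +
    ∑ p ∈ iSet ℓ 6 6 ∪ barSet ℓ (iSet ℓ 4 6),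
      mulA F ℓ Γ j0 (X F ℓ Γ j0 0 (Pi.single p 1)) (pt F ℓ Γ j0 p u)

/-- The contact bracket (2.18):
`[u,v] = Σ_{p∈I} x^{σ_p}(∂_p u·∂_{p̄} v − ∂_{p̄} u·∂_p v) + (2−∂)(u)·∂₀(v) − ∂₀(u)·(2−∂)(v)`. -/
def brk (u v : CA F ℓ Γ j0) : CA F ℓ Γ j0 :=
  (∑ p ∈ iSet ℓ 1 6,
      mulA F ℓ Γ j0 (X F ℓ Γ j0 (sgm F ℓ p) 0)
        (mulA F ℓ Γ j0 (dd F ℓ Γ j0 p u) (dd F ℓ Γ j0 (bar ℓ p) v) -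
          mulA F ℓ Γ j0 (dd F ℓ Γ j0 (bar ℓ p) u) (dd F ℓ Γ j0 p v))) +
    mulA F ℓ Γ j0 ((2 : F) • u - Dop F ℓ Γ j0 u) (dd F ℓ Γ j0 0 v) -
    mulA F ℓ Γ j0 (dd F ℓ Γ j0 0 u) ((2 : F) • v - Dop F ℓ Γ j0 v)


/-- The set `A₁`: the ad-locally-finite but not ad-semisimple basis elements
(`x^{−σ_p}` for `p ∈ I_{2,3}`, `x^{−σ_q,1_{[q̄]}}` for `q ∈ I₅`, plus `1` if `𝒥₀ = ℕ`). -/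
def A1 (F : Type*) [Field F] (ℓ : ℕ → ℕ) (Γ : AddSubgroup (ℕ → F)) (j0 : Bool) :
    Set (CA F ℓ Γ j0) :=
  ((fun p => X F ℓ Γ j0 (-sgm F ℓ p) 0) '' ↑(iSet ℓ 2 3)) ∪
    ((fun q => X F ℓ Γ j0 (-sgm F ℓ q) (Pi.single (bar ℓ q) 1)) '' ↑(iSet ℓ 5 5)) ∪
    {y | j0 = true ∧ y = X F ℓ Γ j0 0 0}

/-- The set `A₂`: the ad-semisimple elements
(`x^{−σ_p}` for `p ∈ I₁`, `x^{−σ_q,1_{[q̄]}}` for `q ∈ I₄`, `t^{1_{[r]}+1_{[r̄]}}` for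
`r ∈ I₆`, plus `1` if `𝒥₀ = {0}`). -/
def A2 (F : Type*) [Field F] (ℓ : ℕ → ℕ) (Γ : AddSubgroup (ℕ → F)) (j0 : Bool) :
    Set (CA F ℓ Γ j0) :=
  ((fun p => X F ℓ Γ j0 (-sgm F ℓ p) 0) '' ↑(iSet ℓ 1 1)) ∪
    ((fun q => X F ℓ Γ j0 (-sgm F ℓ q) (Pi.single (bar ℓ q) 1)) '' ↑(iSet ℓ 4 4)) ∪
    ((fun r => X F ℓ Γ j0 0 (Pi.single r 1 + Pi.single (bar ℓ r) 1)) '' ↑(iSet ℓ 6 6)) ∪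
    {y | j0 = false ∧ y = X F ℓ Γ j0 0 0}

/-- The set `A₃`: `x^{2_{[p]}}` for `p ∈ I_{1,5}`, `t^{2_{[q]}}` for `q ∈ I₆`, plus
`x^{2_{[0]}}` if `Γ₀ ≠ {0}` or `t₀` if `Γ₀ = {0}`. -/
def A3 (F : Type*) [Field F] (ℓ : ℕ → ℕ) (Γ : AddSubgroup (ℕ → F)) (j0 : Bool) :
    Set (CA F ℓ Γ j0) :=
  ((fun p => X F ℓ Γ j0 (Pi.single p (2 : F)) 0) '' ↑(iSet ℓ 1 5)) ∪
    ((fun q => X F ℓ Γ j0 0 (Pi.single q 2)) '' ↑(iSet ℓ 6 6)) ∪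
    {y | ((∃ α ∈ Γ, α 0 ≠ 0) ∧ y = X F ℓ Γ j0 (Pi.single 0 (2 : F)) 0) ∨
      ((∀ α ∈ Γ, α 0 = 0) ∧ y = X F ℓ Γ j0 0 (Pi.single 0 1))}

/-- The set `A₄`: `x^{2_{[p̄]}}` for `p ∈ I_{1,3}`, `t^{2_{[q̄]}}` for `q ∈ I_{4,6}`, plus
`x^{−2_{[0]}}` if `Γ₀ ≠ {0}`. -/
def A4 (F : Type*) [Field F] (ℓ : ℕ → ℕ) (Γ : AddSubgroup (ℕ → F)) (j0 : Bool) :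
    Set (CA F ℓ Γ j0) :=
  ((fun p => X F ℓ Γ j0 (Pi.single (bar ℓ p) (2 : F)) 0) '' ↑(iSet ℓ 1 3)) ∪
    ((fun q => X F ℓ Γ j0 0 (Pi.single (bar ℓ q) 2)) '' ↑(iSet ℓ 4 6)) ∪
    {y | (∃ α ∈ Γ, α 0 ≠ 0) ∧ y = X F ℓ Γ j0 (Pi.single 0 (-2 : F)) 0}

section Helpers

variable {F : Type*} [Field F] {ℓ : ℕ → ℕ} {Γ : AddSubgroup (ℕ → F)} {j0 : Bool}

lemma X_of_mem {α : ℕ → F} {i : ℕ → ℕ} (hα : α ∈ Γ) (hi : i ∈ jIdx ℓ j0) :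
    X F ℓ Γ j0 α i = Finsupp.single (⟨α, hα⟩, ⟨i, hi⟩) 1 := by
  unfold X
  rw [dif_pos ⟨hα, hi⟩]

lemma X_apply_ne {α : ℕ → F} {i : ℕ → ℕ} {a : ↥Γ × ↥(jIdx ℓ j0)}
    (h : X F ℓ Γ j0 α i a ≠ 0) : a.1.1 = α ∧ a.2.1 = i := by
  by_cases hm : α ∈ Γ ∧ i ∈ jIdx ℓ j0
  · rw [X_of_mem hm.1 hm.2, Finsupp.single_apply_ne_zero] at h
    rw [h.1]
    exact ⟨rfl, rfl⟩
  · unfold X at h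
    rw [dif_neg hm] at h
    simp at h

lemma jIdx_add {i j : ℕ → ℕ} (hi : i ∈ jIdx ℓ j0) (hj : j ∈ jIdx ℓ j0) :
    i + j ∈ jIdx ℓ j0 := by
  refine ⟨fun h => ?_, fun p h1 h2 => ?_⟩
  · simp [hi.1 h, hj.1 h]
  · simp [hi.2 p h1 h2, hj.2 p h1 h2]

lemma jIdx_zero : (0 : ℕ → ℕ) ∈ jIdx ℓ j0 := ⟨fun _ => rfl, fun _ _ _ => rfl⟩

/-- The shift of basis indices. -/
def shiftIdx (β : ↥Γ) (j : ↥(jIdx ℓ j0)) (a : ↥Γ × ↥(jIdx ℓ j0)) : ↥Γ × ↥(jIdx ℓ j0) :=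
  (⟨β.1 + a.1.1, Γ.add_mem β.2 a.1.2⟩, ⟨j.1 + a.2.1, jIdx_add j.2 a.2.2⟩)

lemma shiftIdx_inj (β : ↥Γ) (j : ↥(jIdx ℓ j0)) : Function.Injective (shiftIdx β j) := by
  rintro ⟨⟨a, ha⟩, ⟨b, hb⟩⟩ ⟨⟨a', ha'⟩, ⟨b', hb'⟩⟩ h
  simpa [shiftIdx] using h

lemma mulA_smul_X {c : F} {β : ℕ → F} {j : ℕ → ℕ} (hβ : β ∈ Γ) (hj : j ∈ jIdx ℓ j0)
    (v : CA F ℓ Γ j0) :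
    mulA F ℓ Γ j0 (c • X F ℓ Γ j0 β j) v = c • v.mapDomain (shiftIdx ⟨β, hβ⟩ ⟨j, hj⟩) := by
  unfold mulA
  rw [X_of_mem hβ hj, Finsupp.smul_single, Finsupp.sum_single_index]
  · rw [Finsupp.mapDomain, Finsupp.smul_sum]
    refine Finsupp.sum_congr fun b _ => ?_
    rw [X_of_mem (Γ.add_mem hβ b.1.2) (jIdx_add hj b.2.2)]
    simp [shiftIdx]
  · simp

lemma mulA_X {β : ℕ → F} {j : ℕ → ℕ} (hβ : β ∈ Γ) (hj : j ∈ jIdx ℓ j0)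
    (v : CA F ℓ Γ j0) :
    mulA F ℓ Γ j0 (X F ℓ Γ j0 β j) v = v.mapDomain (shiftIdx ⟨β, hβ⟩ ⟨j, hj⟩) := by
  have := mulA_smul_X (c := 1) hβ hj v
  simpa using this

lemma mulA_zero_left (v : CA F ℓ Γ j0) : mulA F ℓ Γ j0 0 v = 0 := by simp [mulA]

lemma mulA_zero_right (v : CA F ℓ Γ j0) : mulA F ℓ Γ j0 v 0 = 0 := by simp [mulA]

lemma mulA_X_eq_zero {β : ℕ → F} {j : ℕ → ℕ} (hβ : β ∈ Γ) (hj : j ∈ jIdx ℓ j0)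
    {v : CA F ℓ Γ j0} (h : mulA F ℓ Γ j0 (X F ℓ Γ j0 β j) v = 0) : v = 0 := by
  rw [mulA_X hβ hj] at h
  exact Finsupp.mapDomain_injective (shiftIdx_inj _ _) (h.trans Finsupp.mapDomain_zero.symm)

lemma mulA_X_X {β α : ℕ → F} {j i : ℕ → ℕ} (hβ : β ∈ Γ) (hj : j ∈ jIdx ℓ j0)
    (hα : α ∈ Γ) (hi : i ∈ jIdx ℓ j0) :
    mulA F ℓ Γ j0 (X F ℓ Γ j0 β j) (X F ℓ Γ j0 α i) = X F ℓ Γ j0 (β + α) (j + i) := by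
  rw [mulA_X hβ hj, X_of_mem hα hi, X_of_mem (Γ.add_mem hβ hα) (jIdx_add hj hi),
    Finsupp.mapDomain_single]
  rfl

lemma mulA_X_smul (c : F) {β : ℕ → F} {j : ℕ → ℕ} (hβ : β ∈ Γ) (hj : j ∈ jIdx ℓ j0)
    (v : CA F ℓ Γ j0) :
    mulA F ℓ Γ j0 (X F ℓ Γ j0 β j) (c • v) = c • mulA F ℓ Γ j0 (X F ℓ Γ j0 β j) v := by
  rw [mulA_X hβ hj, mulA_X hβ hj, Finsupp.mapDomain_smul]

lemma pstar_zero (p : ℕ) : pstar F ℓ Γ j0 p 0 = 0 := by simp [pstar]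
lemma pt_zero (p : ℕ) : pt F ℓ Γ j0 p 0 = 0 := by simp [pt]
lemma dd_zero (p : ℕ) : dd F ℓ Γ j0 p 0 = 0 := by simp [dd, pstar_zero, pt_zero]
lemma Dop_zero : Dop F ℓ Γ j0 0 = 0 := by simp [Dop, pstar_zero, pt_zero, mulA_zero_right]

lemma brk_zero_left (v : CA F ℓ Γ j0) : brk F ℓ Γ j0 0 v = 0 := by
  simp [brk, dd_zero, Dop_zero, mulA_zero_left, mulA_zero_right]

lemma pstar_apply (p : ℕ) (u : CA F ℓ Γ j0) (a) : pstar F ℓ Γ j0 p u a = a.1.1 p * u a := by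
  unfold pstar
  rw [Finsupp.sum_apply, Finsupp.sum, Finset.sum_eq_single a]
  · simp [mul_comm]
  · intro b _ hb
    simp [hb]
  · intro h
    simp only [Finsupp.mem_support_iff, not_not] at h
    simp [h]

lemma pt_apply_ne {p : ℕ} {u : CA F ℓ Γ j0} {a} (h : pt F ℓ Γ j0 p u a ≠ 0) :
    ∃ b ∈ u.support, b.1 = a.1 ∧ b.2.1 p ≠ 0 ∧ a.2.1 = b.2.1 - Pi.single p 1 := by
  unfold pt at h
  rw [Finsupp.sum_apply, Finsupp.sum] at h
  obtain ⟨b, hb, hne⟩ := Finset.exists_ne_zero_of_sum_ne_zero h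
  rw [Finsupp.smul_apply, smul_eq_mul] at hne
  have h1 := left_ne_zero_of_mul hne
  have h2 := X_apply_ne (right_ne_zero_of_mul hne)
  refine ⟨b, hb, Subtype.ext h2.1.symm, ?_, h2.2⟩
  intro h0
  simp [h0] at h1

lemma pt_X (p : ℕ) {α : ℕ → F} {i : ℕ → ℕ} (hα : α ∈ Γ) (hi : i ∈ jIdx ℓ j0) :
    pt F ℓ Γ j0 p (X F ℓ Γ j0 α i) = (i p : F) • X F ℓ Γ j0 α (i - Pi.single p 1) := by
  unfold pt
  rw [X_of_mem hα hi, Finsupp.sum_single_index] <;> simp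

lemma pstar_X (p : ℕ) {α : ℕ → F} {i : ℕ → ℕ} (hα : α ∈ Γ) (hi : i ∈ jIdx ℓ j0) :
    pstar F ℓ Γ j0 p (X F ℓ Γ j0 α i) = α p • X F ℓ Γ j0 α i := by
  unfold pstar
  rw [X_of_mem hα hi, Finsupp.sum_single_index] <;> simp

lemma dd_X (p : ℕ) {α : ℕ → F} {i : ℕ → ℕ} (hα : α ∈ Γ) (hi : i ∈ jIdx ℓ j0) :
    dd F ℓ Γ j0 p (X F ℓ Γ j0 α i) =
      α p • X F ℓ Γ j0 α i + (i p : F) • X F ℓ Γ j0 α (i - Pi.single p 1) := by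
  rw [dd, pstar_X p hα hi, pt_X p hα hi]

lemma dd_X0 (p : ℕ) {α : ℕ → F} (hα : α ∈ Γ) :
    dd F ℓ Γ j0 p (X F ℓ Γ j0 α 0) = α p • X F ℓ Γ j0 α 0 := by
  rw [dd_X p hα jIdx_zero]
  simp

/-- Generalised eigenvector argument: an eigenvector of `c₁∂_r + c₂∂_s` is supported on
exponents with the right eigenvalue. -/
lemma eig_support {r s : ℕ} (hr : r ≤ 2 * iot ℓ 6) (hs : s ≤ 2 * iot ℓ 6) {c₁ c₂ lam : F}
    {w : CA F ℓ Γ j0} (h : c₁ • dd F ℓ Γ j0 r w + c₂ • dd F ℓ Γ j0 s w = lam • w)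
    {a} (ha : a ∈ w.support) : c₁ * a.1.1 r + c₂ * a.1.1 s = lam := by
  classical
  let deg : ↥Γ × ↥(jIdx ℓ j0) → ℕ := fun b => ∑ q ∈ Finset.range (2 * iot ℓ 6 + 1), b.2.1 q
  obtain ⟨b, hb, hmax⟩ := Finset.exists_max_image (w.support.filter fun b => b.1 = a.1) deg
    ⟨a, by simpa using ha⟩
  rw [Finset.mem_filter] at hb
  have key : ∀ r ≤ 2 * iot ℓ 6, pt F ℓ Γ j0 r w b = 0 := by
    intro r hr
    by_contra hne
    obtain ⟨e, he, h1, h2, h3⟩ := pt_apply_ne hne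
    have hle := hmax e (by rw [Finset.mem_filter]; exact ⟨he, h1.trans hb.2⟩)
    have hlt : deg b < deg e := by
      refine Finset.sum_lt_sum (fun q _ => ?_) ⟨r, Finset.mem_range.2 (by omega), ?_⟩
      · rw [h3]
        simp
      · rw [h3]
        simp only [Pi.sub_apply, Pi.single_eq_same]
        omega
    omega
  have hev := DFunLike.congr_fun h b
  simp only [dd, Finsupp.add_apply, Finsupp.smul_apply, smul_eq_mul, pstar_apply, key r hr,
    key s hs, add_zero] at hev
  have hwb : w b ≠ 0 := by simpa using hb.1
  rw [← hb.2]
  apply mul_right_cancel₀ hwb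
  linear_combination hev

lemma dd_zero_support {r : ℕ} (hr : r ≤ 2 * iot ℓ 6)
    {w : CA F ℓ Γ j0} (h : dd F ℓ Γ j0 r w = 0)
    {a} (ha : a ∈ w.support) : a.1.1 r = 0 := by
  have := eig_support (c₁ := 1) (c₂ := 0) (lam := 0) hr hr (w := w) (by simp [h]) ha
  simpa using this

lemma iot_mono {i j : ℕ} (h : i ≤ j) : iot ℓ i ≤ iot ℓ j :=
  Finset.sum_le_sum_of_subset (Finset.Icc_subset_Icc_right h)

lemma iot_zero : iot ℓ 0 = 0 := by simp [iot]

lemma mem_iSet {i j p : ℕ} : p ∈ iSet ℓ i j ↔ iot ℓ (i - 1) + 1 ≤ p ∧ p ≤ iot ℓ j := by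
  simp [iSet]

lemma iSet16 {i j p : ℕ} (hj : j ≤ 6) (hp : p ∈ iSet ℓ i j) : 1 ≤ p ∧ p ≤ iot ℓ 6 := by
  rw [mem_iSet] at hp
  have := iot_mono (ℓ := ℓ) hj
  omega

lemma bar_low {p : ℕ} (h : p ≤ iot ℓ 6) : bar ℓ p = p + iot ℓ 6 := by simp [bar, h]

lemma bar_high {p : ℕ} (h : 1 ≤ p) : bar ℓ (p + iot ℓ 6) = p := by
  unfold bar
  rw [if_neg (by omega)]
  omega

/-- Every `σ_p` lies in `Γ`. -/
lemma sgm_mem (hΓ1 : ∀ p ∈ jSet ℓ 1 3 ∪ iSet ℓ 4 5, (Pi.single p (1 : F) : ℕ → F) ∈ Γ)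
    {p : ℕ} (hp : p ≤ iot ℓ 6) : sgm F ℓ p ∈ Γ := by
  unfold sgm
  simp only [hp, if_true]
  split_ifs with h1 h2
  · refine Γ.sub_mem (Γ.neg_mem (hΓ1 _ ?_)) (hΓ1 _ ?_)
    · simp [jSet, h1]
    · rw [← bar_low hp]
      simp only [jSet, barSet, Finset.mem_union, Finset.mem_image]
      exact Or.inl (Or.inr ⟨p, h1, rfl⟩)
  · exact Γ.neg_mem (hΓ1 _ (by simp [h2]))
  · exact Γ.zero_mem

/-- The Poisson part of the bracket when `u` only involves the variable pair `q, q̄`. -/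
lemma brk_pair {q : ℕ} (hq : q ∈ iSet ℓ 1 6) {u v : CA F ℓ Γ j0}
    (hu : ∀ r, r ≠ q → r ≠ bar ℓ q → dd F ℓ Γ j0 r u = 0)
    (hv : dd F ℓ Γ j0 0 v = 0) :
    brk F ℓ Γ j0 u v = mulA F ℓ Γ j0 (X F ℓ Γ j0 (sgm F ℓ q) 0)
        (mulA F ℓ Γ j0 (dd F ℓ Γ j0 q u) (dd F ℓ Γ j0 (bar ℓ q) v) -
          mulA F ℓ Γ j0 (dd F ℓ Γ j0 (bar ℓ q) u) (dd F ℓ Γ j0 q v)) := by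
  have hq' := iSet16 le_rfl hq
  have hbq := bar_low hq'.2
  unfold brk
  rw [Finset.sum_eq_single q, hv, hu 0 (by omega) (by omega)]
  · simp [mulA_zero_left, mulA_zero_right]
  · intro r hr hrq
    have hr' := iSet16 le_rfl hr
    have hbr := bar_low hr'.2
    rw [hu r hrq (by omega), hu (bar ℓ r) (by omega) (by omega)]
    simp [mulA_zero_left, mulA_zero_right]
  · exact fun h => absurd hq h

/-- Bracket with an element having a single nonzero partial derivative `∂_s`, `s = q`. -/
lemma brk_low (hΓ1 : ∀ p ∈ jSet ℓ 1 3 ∪ iSet ℓ 4 5, (Pi.single p (1 : F) : ℕ → F) ∈ Γ)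
    {q : ℕ} (hq : q ∈ iSet ℓ 1 6) {u v : CA F ℓ Γ j0} {c : F} {β : ℕ → F} {j : ℕ → ℕ}
    (hβ : β ∈ Γ) (hj : j ∈ jIdx ℓ j0)
    (hu : ∀ r, r ≠ q → dd F ℓ Γ j0 r u = 0)
    (hu' : dd F ℓ Γ j0 q u = c • X F ℓ Γ j0 β j)
    (hv : dd F ℓ Γ j0 0 v = 0) :
    brk F ℓ Γ j0 u v = c • mulA F ℓ Γ j0 (X F ℓ Γ j0 (sgm F ℓ q) 0)
        (mulA F ℓ Γ j0 (X F ℓ Γ j0 β j) (dd F ℓ Γ j0 (bar ℓ q) v)) := by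
  have hq' := iSet16 le_rfl hq
  have hbq := bar_low hq'.2
  rw [brk_pair hq (fun r h _ => hu r h) hv, hu', hu (bar ℓ q) (by omega), mulA_zero_left,
    sub_zero, mulA_smul_X hβ hj, ← mulA_X hβ hj, mulA_X_smul c (sgm_mem hΓ1 hq'.2) jIdx_zero]

lemma brk_high (hΓ1 : ∀ p ∈ jSet ℓ 1 3 ∪ iSet ℓ 4 5, (Pi.single p (1 : F) : ℕ → F) ∈ Γ)
    {q : ℕ} (hq : q ∈ iSet ℓ 1 6) {u v : CA F ℓ Γ j0} {c : F} {β : ℕ → F} {j : ℕ → ℕ}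
    (hβ : β ∈ Γ) (hj : j ∈ jIdx ℓ j0)
    (hu : ∀ r, r ≠ bar ℓ q → dd F ℓ Γ j0 r u = 0)
    (hu' : dd F ℓ Γ j0 (bar ℓ q) u = c • X F ℓ Γ j0 β j)
    (hv : dd F ℓ Γ j0 0 v = 0) :
    brk F ℓ Γ j0 u v = (-c) • mulA F ℓ Γ j0 (X F ℓ Γ j0 (sgm F ℓ q) 0)
        (mulA F ℓ Γ j0 (X F ℓ Γ j0 β j) (dd F ℓ Γ j0 q v)) := by
  have hq' := iSet16 le_rfl hq
  have hbq := bar_low hq'.2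
  rw [brk_pair hq (fun r _ h => hu r h) hv, hu', hu q (by omega), mulA_zero_left,
    zero_sub, mulA_smul_X hβ hj, ← mulA_X hβ hj, ← neg_smul,
    mulA_X_smul (-c) (sgm_mem hΓ1 hq'.2) jIdx_zero]

lemma smul_mul_mul_eq_zero {c : F} (hc : c ≠ 0) {α β : ℕ → F} {i j : ℕ → ℕ}
    (hα : α ∈ Γ) (hi : i ∈ jIdx ℓ j0) (hβ : β ∈ Γ) (hj : j ∈ jIdx ℓ j0) {v : CA F ℓ Γ j0} :
    c • mulA F ℓ Γ j0 (X F ℓ Γ j0 α i) (mulA F ℓ Γ j0 (X F ℓ Γ j0 β j) v) = 0 ↔ v = 0 := by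
  constructor
  · intro h
    exact mulA_X_eq_zero hβ hj (mulA_X_eq_zero hα hi ((smul_eq_zero.1 h).resolve_left hc))
  · rintro rfl
    simp [mulA_zero_right]

/-- Bracket with `x^{-σ_p}`, `p ∈ I_{1,3}`. -/
lemma brk_sigma (hΓ1 : ∀ p ∈ jSet ℓ 1 3 ∪ iSet ℓ 4 5, (Pi.single p (1 : F) : ℕ → F) ∈ Γ)
    {p : ℕ} (hp : p ∈ iSet ℓ 1 3) {v : CA F ℓ Γ j0} (hv : dd F ℓ Γ j0 0 v = 0) :
    brk F ℓ Γ j0 (X F ℓ Γ j0 (-sgm F ℓ p) 0) v =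
      dd F ℓ Γ j0 (bar ℓ p) v - dd F ℓ Γ j0 p v := by
  have hp' := iSet16 (by norm_num) hp
  have hb := bar_low hp'.2
  have hs := sgm_mem hΓ1 hp'.2
  have hsn := Γ.neg_mem hs
  have hse : sgm F ℓ p = -Pi.single p (1 : F) - Pi.single (bar ℓ p) (1 : F) := by
    simp [sgm, hp'.2, hp, hb]
  have hne : bar ℓ p ≠ p := by omega
  have hcancel : ∀ z : CA F ℓ Γ j0, mulA F ℓ Γ j0 (X F ℓ Γ j0 (sgm F ℓ p) 0)
      (mulA F ℓ Γ j0 (X F ℓ Γ j0 (-sgm F ℓ p) 0) z) = z := by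
    intro z
    rw [mulA_X hsn jIdx_zero, mulA_X hs jIdx_zero, ← Finsupp.mapDomain_comp]
    convert Finsupp.mapDomain_id
    funext a
    simp [shiftIdx]
  have hdp : (-sgm F ℓ p) p = 1 := by
    rw [hse]
    simp [hne.symm]
  have hdb : (-sgm F ℓ p) (bar ℓ p) = 1 := by
    rw [hse]
    simp [hne]
  have hq : p ∈ iSet ℓ 1 6 := by
    rw [mem_iSet]
    simp only [Nat.sub_self, iot_zero]
    omega
  rw [brk_pair hq _ hv, dd_X0 _ hsn, dd_X0 _ hsn, hdp, hdb, one_smul]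
  · rw [mulA_X hsn jIdx_zero, mulA_X hsn jIdx_zero]
    rw [sub_eq_add_neg, ← neg_one_smul F (Finsupp.mapDomain _ (dd F ℓ Γ j0 p v)),
      ← Finsupp.mapDomain_smul, ← Finsupp.mapDomain_add,
      ← mulA_X hsn jIdx_zero, hcancel, neg_one_smul, sub_eq_add_neg]
  · intro r h1 h2
    rw [dd_X0 _ hsn, hse]
    simp [h1, h2]

/-- Bracket with an element involving the variable `0` only. -/
lemma brk_center {u v : CA F ℓ Γ j0} {c : F} {β : ℕ → F} {j : ℕ → ℕ}
    (hβ : β ∈ Γ) (hj : j ∈ jIdx ℓ j0)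
    (hu : ∀ r, r ≠ 0 → dd F ℓ Γ j0 r u = 0)
    (hu' : dd F ℓ Γ j0 0 u = c • X F ℓ Γ j0 β j)
    (hv : dd F ℓ Γ j0 0 v = 0) :
    brk F ℓ Γ j0 u v =
      (-c) • mulA F ℓ Γ j0 (X F ℓ Γ j0 β j) ((2 : F) • v - Dop F ℓ Γ j0 v) := by
  unfold brk
  rw [Finset.sum_eq_zero, hv, hu', mulA_smul_X hβ hj, ← mulA_X hβ hj, mulA_zero_right]
  · simp
  · intro r hr
    have hr' := iSet16 le_rfl hr
    have hbr := bar_low hr'.2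
    rw [hu r (by omega), hu (bar ℓ r) (by omega)]
    simp [mulA_zero_left, mulA_zero_right]

lemma brk_one (v : CA F ℓ Γ j0) :
    brk F ℓ Γ j0 (X F ℓ Γ j0 0 0) v =
      (2 : F) • mulA F ℓ Γ j0 (X F ℓ Γ j0 0 0) (dd F ℓ Γ j0 0 v) := by
  have h : ∀ r, dd F ℓ Γ j0 r (X F ℓ Γ j0 0 0) = 0 := by
    intro r
    rw [dd_X0 _ Γ.zero_mem]
    simp
  have hD : Dop F ℓ Γ j0 (X F ℓ Γ j0 0 0) = 0 := by
    simp [Dop, pstar_X _ Γ.zero_mem jIdx_zero, pt_X _ Γ.zero_mem jIdx_zero, mulA_zero_right]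
  unfold brk
  simp only [h, hD, sub_zero, mulA_zero_left, sub_self, mulA_zero_right]
  rw [mulA_smul_X Γ.zero_mem jIdx_zero, ← mulA_X Γ.zero_mem jIdx_zero]
  simp

/-- Evaluation of `∂` on elements involving only `x_p, x_p̄` (and `t_p, t_p̄`). -/
lemma Dop_apply
    (hΓ2 : ∀ α ∈ Γ, ∀ p ∈ iSet ℓ 6 6 ∪ barSet ℓ (iSet ℓ 4 6), α p = 0)
    {p : ℕ} (hp : p ∈ iSet ℓ 1 3) {v : CA F ℓ Γ j0}
    (hv : ∀ r, 1 ≤ r → r ≤ 2 * iot ℓ 6 → r ≠ p → r ≠ bar ℓ p → dd F ℓ Γ j0 r v = 0)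
    {a} (ha : a ∈ v.support) :
    Dop F ℓ Γ j0 v a = (a.1.1 p + a.1.1 (bar ℓ p)) * v a := by
  classical
  have hp' := iSet16 (by norm_num) hp
  have hb := bar_low hp'.2
  have hp3 := (mem_iSet.1 hp)
  have m34 := iot_mono (ℓ := ℓ) (show 3 ≤ 4 by norm_num)
  have m35 := iot_mono (ℓ := ℓ) (show 3 ≤ 5 by norm_num)
  have m36 := iot_mono (ℓ := ℓ) (show 3 ≤ 6 by norm_num)
  have m56 := iot_mono (ℓ := ℓ) (show 5 ≤ 6 by norm_num)
  have hpt : ∀ r ∈ iSet ℓ 6 6 ∪ barSet ℓ (iSet ℓ 4 6), pt F ℓ Γ j0 r v = 0 := by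
    intro r hr
    have hps : pstar F ℓ Γ j0 r v = 0 := by
      ext b
      rw [pstar_apply, hΓ2 _ b.1.2 r hr]
      simp
    have hrr : 1 ≤ r ∧ r ≤ 2 * iot ℓ 6 ∧ r ≠ p ∧ r ≠ bar ℓ p := by
      rw [Finset.mem_union, barSet, Finset.mem_image] at hr
      rcases hr with hr | ⟨s, hs, rfl⟩
      · rw [mem_iSet] at hr
        norm_num at hr
        omega
      · have hs' := iSet16 le_rfl hs
        have := bar_low hs'.2
        rw [mem_iSet] at hs
        norm_num at hs
        omega
    have := hv r hrr.1 hrr.2.1 hrr.2.2.1 hrr.2.2.2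
    rw [dd, hps, zero_add] at this
    exact this
  unfold Dop
  rw [Finset.sum_eq_zero (s := iSet ℓ 6 6 ∪ barSet ℓ (iSet ℓ 4 6))
    (fun r hr => by rw [hpt r hr, mulA_zero_right]), add_zero, Finsupp.finsetSum_apply]
  simp only [pstar_apply]
  rw [← Finset.sum_mul]
  congr 1
  have hpm : p ∈ jSet ℓ 1 3 ∪ iSet ℓ 4 5 := by simp [jSet, hp]
  have hbm : bar ℓ p ∈ jSet ℓ 1 3 ∪ iSet ℓ 4 5 := by
    simp only [jSet, barSet, Finset.mem_union, Finset.mem_image]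
    exact Or.inl (Or.inr ⟨p, hp, rfl⟩)
  have hne : p ≠ bar ℓ p := by omega
  rw [← Finset.sum_pair (f := fun r => a.1.1 r) hne]
  symm
  apply Finset.sum_subset
  · intro r hr
    simp only [Finset.mem_insert, Finset.mem_singleton] at hr
    rcases hr with rfl | rfl
    · exact hpm
    · exact hbm
  · intro r hr hr2
    simp only [Finset.mem_insert, Finset.mem_singleton, not_or] at hr2
    have hrr : 1 ≤ r ∧ r ≤ 2 * iot ℓ 6 := by
      simp only [jSet, barSet, Finset.mem_union, Finset.mem_image] at hr
      rcases hr with (hr | ⟨s, hs, rfl⟩) | hr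
      · have := iSet16 (by norm_num) hr
        omega
      · have hs' := iSet16 (by norm_num) hs
        have := bar_low hs'.2
        omega
      · have := iSet16 (by norm_num) hr
        omega
    exact dd_zero_support hrr.2 (hv r hrr.1 hrr.2 hr2.1 hr2.2) ha

lemma single_mem_jIdx {s n : ℕ} (h0 : s ≠ 0)
    (h : s ∉ iSet ℓ 1 2 ∪ iSet ℓ 4 4 ∪ barSet ℓ (iSet ℓ 1 1)) (h2 : s ≤ 2 * iot ℓ 6) :
    (Pi.single s n : ℕ → ℕ) ∈ jIdx ℓ j0 := by
  refine ⟨fun _ => by simp [h0.symm], fun p _ h' => ?_⟩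
  have : p ≠ s := by
    rintro rfl
    rcases h' with h' | h'
    · exact h h'
    · omega
  simp [this]

lemma dd_X_single_x {s r : ℕ} {c : F} (h : (Pi.single s c : ℕ → F) ∈ Γ) (hr : r ≠ s) :
    dd F ℓ Γ j0 r (X F ℓ Γ j0 (Pi.single s c) 0) = 0 := by
  rw [dd_X0 _ h]
  simp [hr]

lemma dd_X_single_x_same {s : ℕ} {c : F} (h : (Pi.single s c : ℕ → F) ∈ Γ) :
    dd F ℓ Γ j0 s (X F ℓ Γ j0 (Pi.single s c) 0) = c • X F ℓ Γ j0 (Pi.single s c) 0 := by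
  rw [dd_X0 _ h]
  simp

lemma dd_X_single_t {s r n : ℕ} (h : (Pi.single s n : ℕ → ℕ) ∈ jIdx ℓ j0) (hr : r ≠ s) :
    dd F ℓ Γ j0 r (X F ℓ Γ j0 0 (Pi.single s n)) = 0 := by
  rw [dd_X _ Γ.zero_mem h]
  simp [hr]

lemma dd_X_single_t_same {s n : ℕ} (h : (Pi.single s n : ℕ → ℕ) ∈ jIdx ℓ j0) :
    dd F ℓ Γ j0 s (X F ℓ Γ j0 0 (Pi.single s n)) =
      (n : F) • X F ℓ Γ j0 0 (Pi.single s (n - 1)) := by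
  have hsub : (Pi.single s n - Pi.single s 1 : ℕ → ℕ) = Pi.single s (n - 1) := by
    funext r
    by_cases hr : r = s
    · subst hr
      simp
    · simp [hr]
  rw [dd_X _ Γ.zero_mem h, hsub]
  simp

end Helpers

/-- **Claim 6.** If a derivation `d` of `𝒦` vanishes on `A₁ ∪ A₂ ∪ A₃ ∪ A₄`,
then `d(x^{k_{[p]}+(2−k)_{[p̄]}}) = 0` for every `p ∈ I_{1,3}` and `k ∈ ℤ`. -/
theorem derivation_vanishes_on_GammaPrime
    {F : Type*} [Field F] [CharZero F] (ℓ : ℕ → ℕ) (Γ : AddSubgroup (ℕ → F)) (j0 : Bool)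
    (hℓ : 0 < iot ℓ 6)
    (hΓ1 : ∀ p ∈ jSet ℓ 1 3 ∪ iSet ℓ 4 5, (Pi.single p (1 : F) : ℕ → F) ∈ Γ)
    (hΓ2 : ∀ α ∈ Γ, ∀ p ∈ iSet ℓ 6 6 ∪ barSet ℓ (iSet ℓ 4 6), α p = 0)
    (hΓ3 : ∀ α ∈ Γ, ∀ p, 2 * iot ℓ 6 < p → α p = 0)
    (hΓ0 : (∃ α ∈ Γ, α 0 ≠ 0) → (Pi.single 0 (1 : F) : ℕ → F) ∈ Γ)
    (hJ0 : j0 = false → ∃ α ∈ Γ, α 0 ≠ 0)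
    (d : CA F ℓ Γ j0 →ₗ[F] CA F ℓ Γ j0)
    (hd : ∀ u v : CA F ℓ Γ j0,
      d (brk F ℓ Γ j0 u v) = brk F ℓ Γ j0 (d u) v + brk F ℓ Γ j0 u (d v))
    (hvan : ∀ y ∈ A1 F ℓ Γ j0 ∪ A2 F ℓ Γ j0 ∪ A3 F ℓ Γ j0 ∪ A4 F ℓ Γ j0, d y = 0) :
    ∀ p ∈ iSet ℓ 1 3, ∀ k : ℤ,
      d (X F ℓ Γ j0 (Pi.single p ((k : F)) + Pi.single (bar ℓ p) (((2 - k : ℤ) : F))) 0)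
        = 0 := by
  intro p hp
  have hp' := iSet16 (by norm_num) hp
  have hb := bar_low hp'.2
  have hne : bar ℓ p ≠ p := by omega
  have m12 := iot_mono (ℓ := ℓ) (show 1 ≤ 2 by norm_num)
  have m23 := iot_mono (ℓ := ℓ) (show 2 ≤ 3 by norm_num)
  have m34 := iot_mono (ℓ := ℓ) (show 3 ≤ 4 by norm_num)
  have m45 := iot_mono (ℓ := ℓ) (show 4 ≤ 5 by norm_num)
  have m56 := iot_mono (ℓ := ℓ) (show 5 ≤ 6 by norm_num)
  have hI16 : ∀ q, 1 ≤ q → q ≤ iot ℓ 6 → q ∈ iSet ℓ 1 6 := by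
    intro q h1 h2
    rw [mem_iSet]
    simp only [Nat.sub_self, iot_zero]
    omega
  have hbarmem : ∀ q ∈ iSet ℓ 1 3, bar ℓ q ∈ jSet ℓ 1 3 ∪ iSet ℓ 4 5 := by
    intro q hq
    simp only [jSet, barSet, Finset.mem_union, Finset.mem_image]
    exact Or.inl (Or.inr ⟨q, hq, rfl⟩)
  have hzmul : ∀ (s : ℕ) (n : ℤ), (Pi.single s (1 : F) : ℕ → F) ∈ Γ →
      (Pi.single s (n : F) : ℕ → F) ∈ Γ := by
    intro s n h
    have h2 := Γ.zsmul_mem h n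
    rwa [← Pi.single_smul, zsmul_one] at h2
  have htwo : ∀ s : ℕ, (Pi.single s (1 : F) : ℕ → F) ∈ Γ →
      (Pi.single s (2 : F) : ℕ → F) ∈ Γ := by
    intro s h
    have := hzmul s 2 h
    simpa using this
  have hpΓ := hΓ1 p (by simp [jSet, hp])
  have hbΓ := hΓ1 _ (hbarmem p hp)
  have hmem : ∀ k : ℤ, (Pi.single p ((k : F)) + Pi.single (bar ℓ p) (((2 - k : ℤ) : F)) : ℕ → F)
      ∈ Γ := fun k => Γ.add_mem (hzmul _ _ hpΓ) (hzmul _ _ hbΓ)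
  have hdu : ∀ u v, d u = 0 → d (brk F ℓ Γ j0 u v) = brk F ℓ Γ j0 u (d v) := by
    intro u v h
    rw [hd, h, brk_zero_left, zero_add]
  obtain ⟨Y, hY⟩ : ∃ Y : ℤ → CA F ℓ Γ j0, ∀ k, Y k =
      X F ℓ Γ j0 (Pi.single p ((k : F)) + Pi.single (bar ℓ p) (((2 - k : ℤ) : F))) 0 :=
    ⟨_, fun _ => rfl⟩
  have hYp : ∀ k, dd F ℓ Γ j0 p (Y k) = (k : F) • Y k := by
    intro k
    rw [hY, dd_X0 _ (hmem k)]
    simp [hne.symm]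
  have hYb : ∀ k, dd F ℓ Γ j0 (bar ℓ p) (Y k) = ((2 - k : ℤ) : F) • Y k := by
    intro k
    rw [hY, dd_X0 _ (hmem k)]
    simp [hne]
  have hYr : ∀ k r, r ≠ p → r ≠ bar ℓ p → dd F ℓ Γ j0 r (Y k) = 0 := by
    intro k r h1 h2
    rw [hY, dd_X0 _ (hmem k)]
    simp [h1, h2]
  have hY0 : ∀ k, dd F ℓ Γ j0 0 (Y k) = 0 := fun k => hYr k 0 (by omega) (by omega)
  -- `∂₀` kills `d(Y k)`
  have hd1 : d (X F ℓ Γ j0 0 0) = 0 := by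
    apply hvan
    cases j0
    · exact Or.inl (Or.inl (Or.inr (Or.inr ⟨rfl, rfl⟩)))
    · exact Or.inl (Or.inl (Or.inl (Or.inr ⟨rfl, rfl⟩)))
  have hw0 : ∀ k, dd F ℓ Γ j0 0 (d (Y k)) = 0 := by
    intro k
    have h := hdu _ (Y k) hd1
    rw [brk_one, brk_one, hY0 k, mulA_zero_right, smul_zero, map_zero] at h
    exact mulA_X_eq_zero Γ.zero_mem jIdx_zero ((smul_eq_zero.1 h.symm).resolve_left two_ne_zero)
  -- the other partial derivatives kill `d(Y k)`
  have hlow : ∀ (u : CA F ℓ Γ j0) (q : ℕ) (c : F) (β : ℕ → F) (j : ℕ → ℕ), 1 ≤ q →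
      q ≤ iot ℓ 6 → c ≠ 0 → β ∈ Γ → j ∈ jIdx ℓ j0 →
      (∀ r, r ≠ q → dd F ℓ Γ j0 r u = 0) → dd F ℓ Γ j0 q u = c • X F ℓ Γ j0 β j →
      d u = 0 → ∀ k, d (brk F ℓ Γ j0 u (Y k)) = 0 → dd F ℓ Γ j0 (bar ℓ q) (d (Y k)) = 0 := by
    intro u q c β j h1 h2 hc hβ hj hu hu' hdu0 k hk
    rw [hdu _ _ hdu0, brk_low hΓ1 (hI16 q h1 h2) hβ hj hu hu' (hw0 k)] at hk
    exact (smul_mul_mul_eq_zero hc (sgm_mem hΓ1 h2) jIdx_zero hβ hj).1 hk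
  have hhigh : ∀ (u : CA F ℓ Γ j0) (q : ℕ) (c : F) (β : ℕ → F) (j : ℕ → ℕ), 1 ≤ q →
      q ≤ iot ℓ 6 → c ≠ 0 → β ∈ Γ → j ∈ jIdx ℓ j0 →
      (∀ r, r ≠ bar ℓ q → dd F ℓ Γ j0 r u = 0) →
      dd F ℓ Γ j0 (bar ℓ q) u = c • X F ℓ Γ j0 β j →
      d u = 0 → ∀ k, d (brk F ℓ Γ j0 u (Y k)) = 0 → dd F ℓ Γ j0 q (d (Y k)) = 0 := by
    intro u q c β j h1 h2 hc hβ hj hu hu' hdu0 k hk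
    rw [hdu _ _ hdu0, brk_high hΓ1 (hI16 q h1 h2) hβ hj hu hu' (hw0 k)] at hk
    exact (smul_mul_mul_eq_zero (neg_ne_zero.2 hc) (sgm_mem hΓ1 h2) jIdx_zero hβ hj).1 hk
  have hwr : ∀ k r, 1 ≤ r → r ≤ 2 * iot ℓ 6 → r ≠ p → r ≠ bar ℓ p →
      dd F ℓ Γ j0 r (d (Y k)) = 0 := by
    intro k r h1 h2 hrp hrb
    by_cases hr : r ≤ iot ℓ 6
    · have hbr := bar_low hr
      by_cases hr3 : r ≤ iot ℓ 3
      · have hrI : r ∈ iSet ℓ 1 3 := by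
          rw [mem_iSet]
          simp only [Nat.sub_self, iot_zero]
          omega
        have hm := htwo _ (hΓ1 _ (hbarmem r hrI))
        refine hhigh (X F ℓ Γ j0 (Pi.single (bar ℓ r) (2 : F)) 0) r 2 _ 0 h1 hr two_ne_zero hm
          jIdx_zero (fun s hs => dd_X_single_x hm hs) (dd_X_single_x_same hm) ?_ k ?_
        · exact hvan _ (Or.inr (Or.inl (Or.inl ⟨r, hrI, rfl⟩)))
        · rw [brk_high hΓ1 (hI16 r h1 hr) hm jIdx_zero (fun s hs => dd_X_single_x hm hs)
            (dd_X_single_x_same hm) (hY0 k), hYr k r hrp hrb]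
          simp [mulA_zero_right]
      · have hrI : r ∈ iSet ℓ 4 6 := by
          rw [mem_iSet]
          norm_num
          omega
        have hm : ∀ n, (Pi.single (bar ℓ r) n : ℕ → ℕ) ∈ jIdx ℓ j0 := by
          intro n
          refine single_mem_jIdx (by omega) ?_ (by omega)
          simp only [Finset.mem_union, barSet, Finset.mem_image, not_or, not_exists, not_and]
          refine ⟨⟨fun h => ?_, fun h => ?_⟩, fun q hq h => ?_⟩
          · have := iSet16 (by norm_num) h
            omega
          · have := iSet16 (by norm_num) h
            omega
          · have hq' := iSet16 (by norm_num) hq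
            have := bar_low hq'.2
            rw [mem_iSet] at hq
            omega
        have h2t := dd_X_single_t_same (F := F) (Γ := Γ) (hm 2)
        refine hhigh (X F ℓ Γ j0 0 (Pi.single (bar ℓ r) 2)) r _ 0 _ h1 hr ?_ Γ.zero_mem
          (hm (2 - 1)) (fun s hs => dd_X_single_t (hm 2) hs) h2t ?_ k ?_
        · simp
        · exact hvan _ (Or.inr (Or.inl (Or.inr ⟨r, hrI, rfl⟩)))
        · rw [brk_high hΓ1 (hI16 r h1 hr) Γ.zero_mem (hm (2 - 1))
            (fun s hs => dd_X_single_t (hm 2) hs) h2t (hY0 k), hYr k r hrp hrb]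
          simp [mulA_zero_right]
    · obtain ⟨q, rfl⟩ : ∃ q, r = q + iot ℓ 6 := ⟨r - iot ℓ 6, by omega⟩
      have hq1 : 1 ≤ q := by omega
      have hq2 : q ≤ iot ℓ 6 := by omega
      have hbq := bar_low hq2
      rw [← hbq] at hrp hrb ⊢
      by_cases hq5 : q ≤ iot ℓ 5
      · have hqI : q ∈ iSet ℓ 1 5 := by
          rw [mem_iSet]
          simp only [Nat.sub_self, iot_zero]
          omega
        have hm := htwo _ (hΓ1 q (by
          simp only [jSet, Finset.mem_union, mem_iSet, Nat.sub_self, iot_zero]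
          norm_num
          omega))
        refine hlow (X F ℓ Γ j0 (Pi.single q (2 : F)) 0) q 2 _ 0 hq1 hq2 two_ne_zero hm
          jIdx_zero (fun s hs => dd_X_single_x hm hs) (dd_X_single_x_same hm) ?_ k ?_
        · exact hvan _ (Or.inl (Or.inr (Or.inl (Or.inl ⟨q, hqI, rfl⟩))))
        · rw [brk_low hΓ1 (hI16 q hq1 hq2) hm jIdx_zero (fun s hs => dd_X_single_x hm hs)
            (dd_X_single_x_same hm) (hY0 k), hYr k _ hrp hrb]
          simp [mulA_zero_right]
      · have hqI : q ∈ iSet ℓ 6 6 := by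
          rw [mem_iSet]
          norm_num
          omega
        have hm : ∀ n, (Pi.single q n : ℕ → ℕ) ∈ jIdx ℓ j0 := by
          intro n
          refine single_mem_jIdx (by omega) ?_ (by omega)
          simp only [Finset.mem_union, barSet, Finset.mem_image, not_or, not_exists, not_and]
          refine ⟨⟨fun h => ?_, fun h => ?_⟩, fun s hs h => ?_⟩
          · rw [mem_iSet] at h
            omega
          · rw [mem_iSet] at h
            omega
          · have hs' := iSet16 (by norm_num) hs
            have := bar_low hs'.2
            omega
        have h2t := dd_X_single_t_same (F := F) (Γ := Γ) (hm 2)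
        refine hlow (X F ℓ Γ j0 0 (Pi.single q 2)) q _ 0 _ hq1 hq2 ?_ Γ.zero_mem
          (hm (2 - 1)) (fun s hs => dd_X_single_t (hm 2) hs) h2t ?_ k ?_
        · simp
        · exact hvan _ (Or.inl (Or.inr (Or.inl (Or.inr ⟨q, hqI, rfl⟩))))
        · rw [brk_low hΓ1 (hI16 q hq1 hq2) Γ.zero_mem (hm (2 - 1))
            (fun s hs => dd_X_single_t (hm 2) hs) h2t (hY0 k), hYr k _ hrp hrb]
          simp [mulA_zero_right]
  -- Euler operator
  have hYD : ∀ k, (2 : F) • Y k - Dop F ℓ Γ j0 (Y k) = 0 := by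
    intro k
    have hD : Dop F ℓ Γ j0 (Y k) = (2 : F) • Y k := by
      have hpt : ∀ r, pt F ℓ Γ j0 r (Y k) = 0 := by
        intro r
        rw [hY, pt_X _ (hmem k) jIdx_zero]
        simp
      have hps : ∀ r, pstar F ℓ Γ j0 r (Y k) = dd F ℓ Γ j0 r (Y k) := by
        intro r
        rw [dd, hpt, add_zero]
      unfold Dop
      simp only [hpt, mulA_zero_right, Finset.sum_const_zero, add_zero, hps]
      rw [← Finset.sum_subset (s₁ := {p, bar ℓ p}), Finset.sum_pair hne.symm, hYp, hYb,
        ← add_smul]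
      · congr 1
        push_cast
        ring
      · intro r hr
        simp only [Finset.mem_insert, Finset.mem_singleton] at hr
        rcases hr with rfl | rfl
        · simp [jSet, hp]
        · exact hbarmem p hp
      · intro r _ hr
        simp only [Finset.mem_insert, Finset.mem_singleton, not_or] at hr
        exact hYr k r hr.1 hr.2
    rw [hD, sub_self]
  have hcen : ∀ (u : CA F ℓ Γ j0) (c : F) (β : ℕ → F) (j : ℕ → ℕ), c ≠ 0 → β ∈ Γ →
      j ∈ jIdx ℓ j0 → (∀ r, r ≠ 0 → dd F ℓ Γ j0 r u = 0) →
      dd F ℓ Γ j0 0 u = c • X F ℓ Γ j0 β j → d u = 0 → ∀ k,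
      (2 : F) • d (Y k) - Dop F ℓ Γ j0 (d (Y k)) = 0 := by
    intro u c β j hc hβ hj hu hu' hdu0 k
    have h := hdu _ (Y k) hdu0
    rw [brk_center hβ hj hu hu' (hY0 k), brk_center hβ hj hu hu' (hw0 k), hYD,
      mulA_zero_right, smul_zero, map_zero] at h
    exact mulA_X_eq_zero hβ hj ((smul_eq_zero.1 h.symm).resolve_left (neg_ne_zero.2 hc))
  have hwD : ∀ k, (2 : F) • d (Y k) - Dop F ℓ Γ j0 (d (Y k)) = 0 := by
    by_cases hG : ∃ α ∈ Γ, α 0 ≠ 0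
    · have hm := htwo 0 (hΓ0 hG)
      exact hcen (X F ℓ Γ j0 (Pi.single 0 (2 : F)) 0) 2 _ 0 two_ne_zero hm jIdx_zero
        (fun s hs => dd_X_single_x hm hs) (dd_X_single_x_same hm)
        (hvan _ (Or.inl (Or.inr (Or.inr (Or.inl ⟨hG, rfl⟩)))))
    · have hj0 : j0 = true := by
        cases j0
        · exact absurd (hJ0 rfl) hG
        · rfl
      have hm : ∀ n, (Pi.single 0 n : ℕ → ℕ) ∈ jIdx ℓ j0 := by
        intro n
        refine ⟨fun h => by simp [hj0] at h, fun q hq _ => ?_⟩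
        have : q ≠ 0 := by omega
        simp [this]
      have h1t := dd_X_single_t_same (F := F) (Γ := Γ) (hm 1)
      refine hcen (X F ℓ Γ j0 0 (Pi.single 0 1)) _ 0 _ ?_ Γ.zero_mem (hm (1 - 1))
        (fun s hs => dd_X_single_t (hm 1) hs) h1t
        (hvan _ (Or.inl (Or.inr (Or.inr (Or.inr ⟨?_, rfl⟩)))))
      · simp
      · push Not at hG
        exact hG
  -- the grading element `x^{-σ_p}`
  have hds : d (X F ℓ Γ j0 (-sgm F ℓ p) 0) = 0 := by
    apply hvan
    by_cases h1 : p ≤ iot ℓ 1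
    · refine Or.inl (Or.inl (Or.inr (Or.inl (Or.inl (Or.inl ⟨p, ?_, rfl⟩)))))
      rw [Finset.mem_coe, mem_iSet]
      simp only [Nat.sub_self, iot_zero]
      omega
    · refine Or.inl (Or.inl (Or.inl (Or.inl (Or.inl ⟨p, ?_, rfl⟩))))
      rw [mem_iSet] at hp
      rw [Finset.mem_coe, mem_iSet]
      norm_num
      omega
  have hsig : ∀ k : ℤ, (1 : F) • dd F ℓ Γ j0 (bar ℓ p) (d (Y k)) +
      (-1 : F) • dd F ℓ Γ j0 p (d (Y k)) = (2 - 2 * (k : F)) • d (Y k) := by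
    intro k
    have h := hdu _ (Y k) hds
    rw [brk_sigma hΓ1 hp (hY0 k), brk_sigma hΓ1 hp (hw0 k), hYb, hYp, ← sub_smul, map_smul] at h
    rw [one_smul, neg_one_smul, ← sub_eq_add_neg, ← h]
    congr 1
    push_cast
    ring
  have hsum : ∀ k : ℤ, ∀ a ∈ (d (Y k)).support, a.1.1 p + a.1.1 (bar ℓ p) = 2 := by
    intro k a ha
    have h := DFunLike.congr_fun (hwD k) a
    rw [Finsupp.sub_apply, Dop_apply hΓ2 hp (hwr k) ha] at h
    simp only [Finsupp.smul_apply, smul_eq_mul, Finsupp.coe_zero, Pi.zero_apply] at h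
    have hwa : d (Y k) a ≠ 0 := by simpa using ha
    apply mul_right_cancel₀ hwa
    linear_combination -h
  have hpl : p ≤ 2 * iot ℓ 6 := by omega
  have hbl : bar ℓ p ≤ 2 * iot ℓ 6 := by omega
  have hz1 : ∀ k : ℤ, k ≠ 0 → dd F ℓ Γ j0 p (d (Y k)) = 0 → d (Y k) = 0 := by
    intro k hk h
    rw [← Finsupp.support_eq_empty, Finset.eq_empty_iff_forall_notMem]
    intro a ha
    have e1 := dd_zero_support hpl h ha
    have e2 := eig_support hbl hpl (hsig k) ha
    have e3 := hsum k a ha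
    have : (k : F) = 0 := by
      have h2 : (2 : F) * k = 0 := by linear_combination e2 + 2 * e1 - e3
      exact (mul_eq_zero.1 h2).resolve_left two_ne_zero
    exact hk (by exact_mod_cast this)
  have hz2 : ∀ k : ℤ, k ≠ 2 → dd F ℓ Γ j0 (bar ℓ p) (d (Y k)) = 0 → d (Y k) = 0 := by
    intro k hk h
    rw [← Finsupp.support_eq_empty, Finset.eq_empty_iff_forall_notMem]
    intro a ha
    have e1 := dd_zero_support hbl h ha
    have e2 := eig_support hbl hpl (hsig k) ha
    have e3 := hsum k a ha
    have : (k : F) = 2 := by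
      have h2 : (2 : F) * (k - 2) = 0 := by linear_combination e2 - 2 * e1 + e3
      exact sub_eq_zero.1 ((mul_eq_zero.1 h2).resolve_left two_ne_zero)
    exact hk (by exact_mod_cast this)
  -- the induction
  have hse : sgm F ℓ p = -Pi.single p (1 : F) - Pi.single (bar ℓ p) (1 : F) := by
    simp [sgm, hp'.2, hp, hb]
  have hsm := sgm_mem hΓ1 hp'.2
  have hup : ∀ k : ℤ, k + 1 ≠ 0 → d (Y k) = 0 → d (Y (k + 1)) = 0 := by
    intro k hk h0
    apply hz1 _ hk
    have hm := htwo _ hbΓ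
    refine hhigh (X F ℓ Γ j0 (Pi.single (bar ℓ p) (2 : F)) 0) p 2 _ 0 hp'.1 hp'.2 two_ne_zero hm
      jIdx_zero (fun s hs => dd_X_single_x hm hs) (dd_X_single_x_same hm) ?_ _ ?_
    · exact hvan _ (Or.inr (Or.inl (Or.inl ⟨p, hp, rfl⟩)))
    · rw [brk_high hΓ1 (hI16 p hp'.1 hp'.2) hm jIdx_zero (fun s hs => dd_X_single_x hm hs)
        (dd_X_single_x_same hm) (hY0 _), hYp, mulA_X_smul _ hm jIdx_zero,
        mulA_X_smul _ hsm jIdx_zero, hY (k + 1), mulA_X_X hm jIdx_zero (hmem _) jIdx_zero,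
        mulA_X_X hsm jIdx_zero (Γ.add_mem hm (hmem _)) (jIdx_add jIdx_zero jIdx_zero)]
      have : X F ℓ Γ j0 (sgm F ℓ p + (Pi.single (bar ℓ p) (2 : F) +
          (Pi.single p (((k + 1 : ℤ) : F)) + Pi.single (bar ℓ p) (((2 - (k + 1) : ℤ) : F)))))
          (0 + (0 + 0)) = Y k := by
        rw [hY, hse]
        congr 1
        funext r
        simp only [Pi.add_apply, Pi.sub_apply, Pi.neg_apply, Pi.single_apply]
        push_cast
        split_ifs <;> ring
      rw [this, map_smul, map_smul, h0, smul_zero, smul_zero]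
  have hdown : ∀ k : ℤ, k - 1 ≠ 2 → d (Y k) = 0 → d (Y (k - 1)) = 0 := by
    intro k hk h0
    apply hz2 _ hk
    have hm := htwo _ hpΓ
    refine hlow (X F ℓ Γ j0 (Pi.single p (2 : F)) 0) p 2 _ 0 hp'.1 hp'.2 two_ne_zero hm
      jIdx_zero (fun s hs => dd_X_single_x hm hs) (dd_X_single_x_same hm) ?_ _ ?_
    · refine hvan _ (Or.inl (Or.inr (Or.inl (Or.inl ⟨p, ?_, rfl⟩))))
      rw [mem_iSet] at hp
      rw [Finset.mem_coe, mem_iSet]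
      omega
    · rw [brk_low hΓ1 (hI16 p hp'.1 hp'.2) hm jIdx_zero (fun s hs => dd_X_single_x hm hs)
        (dd_X_single_x_same hm) (hY0 _), hYb, mulA_X_smul _ hm jIdx_zero,
        mulA_X_smul _ hsm jIdx_zero, hY (k - 1), mulA_X_X hm jIdx_zero (hmem _) jIdx_zero,
        mulA_X_X hsm jIdx_zero (Γ.add_mem hm (hmem _)) (jIdx_add jIdx_zero jIdx_zero)]
      have : X F ℓ Γ j0 (sgm F ℓ p + (Pi.single p (2 : F) +
          (Pi.single p (((k - 1 : ℤ) : F)) + Pi.single (bar ℓ p) (((2 - (k - 1) : ℤ) : F)))))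
          (0 + (0 + 0)) = Y k := by
        rw [hY, hse]
        congr 1
        funext r
        simp only [Pi.add_apply, Pi.sub_apply, Pi.neg_apply, Pi.single_apply]
        push_cast
        split_ifs <;> ring
      rw [this, map_smul, map_smul, h0, smul_zero, smul_zero]
  have hbase : d (Y 0) = 0 := by
    apply hvan
    refine Or.inr (Or.inl (Or.inl ⟨p, hp, ?_⟩))
    rw [hY]
    simp
  have hposn : ∀ n : ℕ, d (Y (n : ℤ)) = 0 := by
    intro n
    induction n with
    | zero => exact hbase
    | succ n ih =>
      have := hup n (by omega) ih
      exact_mod_cast this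
  have hnegn : ∀ n : ℕ, d (Y (-(n : ℤ))) = 0 := by
    intro n
    induction n with
    | zero => exact hbase
    | succ n ih =>
      have := hdown (-(n : ℤ)) (by omega) ih
      have e : -(((n + 1 : ℕ)) : ℤ) = -(n : ℤ) - 1 := by
        push_cast
        ring
      rw [e]
      exact this
  intro k
  rw [← hY]
  rcases Int.eq_nat_or_neg k with ⟨n, rfl | rfl⟩
  · exact hposn n
  · exact hnegn n

end
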